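/- If X is simple and atomic and m > 1, then β := β(X^(m)) is a divisor of m, and there is a Blackwell decomposition {C_0, C_1, ..., C_{β−1}} for X^(m) consisting of pairwise disjoint atomic almost closed sets which can be chosen such that for each i = 0, 1, ..., β−1 and each j = 0, 1, ..., m−1, ℙ(θ^j L^(m)(C_{i+1 (mod β)}) | θ^{j+1} L^(m)(C_i)) = 1. Moreover, if X is simple and nonatomic, then X^(m) is simple and nonatomic for all m ≥ 1. -/

import Mathlib

open MeasureTheory Filter Set ProbabilityTheory

/-- A discrete-time Markov chain on a state space `S`: a stochastic transition
matrix `P`, an initial distribution `init`, and the induced probability measure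
`μ` on the path space `ℕ → S`, determined by its values on cylinder sets. -/
structure MarkovChain (S : Type) [MeasurableSpace S] where
  P : S → S → ℝ
  P_nonneg : ∀ i j, 0 ≤ P i j
  P_stochastic : ∀ i, HasSum (P i) 1
  init : S → ℝ
  init_nonneg : ∀ i, 0 ≤ init i
  init_hasSum : HasSum init 1
  μ : Measure (ℕ → S)
  μ_prob : IsProbabilityMeasure μ
  μ_cylinder : ∀ (n : ℕ) (s : ℕ → S),
    μ {ω | ∀ k ≤ n, ω k = s k}
      = ENNReal.ofReal (init (s 0) * ∏ k ∈ Finset.range n, P (s k) (s (k + 1)))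

namespace MarkovChain

variable {S : Type} [MeasurableSpace S]

open Classical in
/-- The `n`-step transition probabilities `P^n(i,j)`. -/
noncomputable def Pn (X : MarkovChain S) : ℕ → S → S → ℝ
  | 0, i, j => if i = j then 1 else 0
  | n + 1, i, j => ∑' k : S, X.Pn n i k * X.P k j

/-- Irreducibility: every state can be reached from every state. -/
def Irreducible (X : MarkovChain S) : Prop := ∀ i j : S, ∃ n : ℕ, 0 < X.Pn n i j

/-- Aperiodicity: for each state, the gcd of the set `{n ≥ 1 | P^n(i,i) > 0}`
is `1` (expressed via common divisors). -/
def Aperiodic (X : MarkovChain S) : Prop :=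
  ∀ i : S, ∀ d : ℕ, (∀ n : ℕ, 0 < n → 0 < X.Pn n i i → d ∣ n) → d = 1

/-- `U^(m)(C)`: the event that the `m`-step chain visits `C` infinitely often. -/
def U (X : MarkovChain S) (m : ℕ) (C : Set S) : Set (ℕ → S) :=
  {ω | ∀ n : ℕ, ∃ k : ℕ, n ≤ k ∧ ω (k * m) ∈ C}

/-- `L^(m)(C)`: the event that the `m`-step chain is eventually in `C`. -/
def L (X : MarkovChain S) (m : ℕ) (C : Set S) : Set (ℕ → S) :=
  {ω | ∃ n : ℕ, ∀ k : ℕ, n ≤ k → ω (k * m) ∈ C}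

/-- `C` is transient with respect to the `m`-step chain `X^(m)`. -/
def Transient (X : MarkovChain S) (m : ℕ) (C : Set S) : Prop := X.μ (X.U m C) = 0

/-- `C` is regular with respect to `X^(m)`: `U^(m)(C)` and `L^(m)(C)` agree up
to a null event. -/
def Regular (X : MarkovChain S) (m : ℕ) (C : Set S) : Prop :=
  X.μ (symmDiff (X.U m C) (X.L m C)) = 0

/-- `C` is almost closed with respect to `X^(m)`: regular but not transient. -/
def AlmostClosed (X : MarkovChain S) (m : ℕ) (C : Set S) : Prop :=
  X.Regular m C ∧ ¬ X.Transient m C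

/-- An almost closed set is atomic if it does not contain two disjoint almost
closed subsets. -/
def Atomic (X : MarkovChain S) (m : ℕ) (C : Set S) : Prop :=
  X.AlmostClosed m C ∧
    ¬ ∃ A B : Set S, A ⊆ C ∧ B ⊆ C ∧ Disjoint A B ∧
      X.AlmostClosed m A ∧ X.AlmostClosed m B

/-- A Blackwell decomposition for the `m`-step chain `X^(m)`: a countable
collection of pairwise disjoint almost closed sets, all atomic except at most
one, where a nonatomic member contains no atomic subsets and consists of
transient states, and such that the probabilities `μ(L^(m)(C))` sum to one. -/
structure IsBlackwell (X : MarkovChain S) (m : ℕ) (𝒞 : Set (Set S)) : Prop where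
  countable : 𝒞.Countable
  almostClosed : ∀ C ∈ 𝒞, X.AlmostClosed m C
  disjoint : 𝒞.PairwiseDisjoint id
  atMostOneNonatomic : ∀ C₁ ∈ 𝒞, ∀ C₂ ∈ 𝒞, ¬ X.Atomic m C₁ → ¬ X.Atomic m C₂ → C₁ = C₂
  nonatomicNoAtomicSubset : ∀ C ∈ 𝒞, ¬ X.Atomic m C → ∀ A : Set S, A ⊆ C → ¬ X.Atomic m A
  nonatomicTransientStates : ∀ C ∈ 𝒞, ¬ X.Atomic m C → ∀ i ∈ C, X.Transient m {i}
  sum_L_eq_one : ∑' C : 𝒞, X.μ (X.L m (C : Set S)) = 1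

/-- `β(X^(m))`: the number of sets in a Blackwell decomposition for `X^(m)`
(well defined since the decomposition is unique up to equivalence). -/
noncomputable def beta (X : MarkovChain S) (m : ℕ) : ℕ∞ :=
  sInf (Set.encard '' {𝒞 : Set (Set S) | X.IsBlackwell m 𝒞})

/-- `X` is simple if `β(X) = 1`. -/
def Simple (X : MarkovChain S) : Prop := X.beta 1 = 1

/-- The asymptotic period `d(X) = sup {m ≥ 1 | β(X^(m)) = m}` (possibly `∞`). -/
noncomputable def period (X : MarkovChain S) : ℕ∞ :=
  sSup {d : ℕ∞ | ∃ m : ℕ, 1 ≤ m ∧ X.beta m = (m : ℕ∞) ∧ d = (m : ℕ∞)}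

/-- Recurrence: every state is visited infinitely often almost surely. -/
def Recurrent (X : MarkovChain S) : Prop := ∀ i : S, X.μ (X.U 1 {i}) = 1

end MarkovChain

/-- The shift operator `θ` on path space: `(θ ω)(n) = ω(n+1)`. -/
def pathShift {S : Type} : (ℕ → S) → ℕ → S := fun ω n => ω (n + 1)

/-- An event `E` is `m`-invariant if its indicator function `f` satisfies
`f(ω) = f(θ^m ω)` for all paths `ω`. -/
def MInvariant {S : Type} (m : ℕ) (E : Set (ℕ → S)) : Prop :=
  ∀ ω : ℕ → S, ω ∈ E ↔ pathShift^[m] ω ∈ E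

/-- A birth-death process: a Markov chain on `ℕ` with positive birth
probabilities `p_i = P(i,i+1)`, positive death probabilities `q_{i+1} = P(i+1,i)`,
all transition probabilities other than `p_i`, `q_i` and `r_i = P(i,i)` zero,
and at least one positive self-transition probability. -/
structure MarkovChain.IsBirthDeath (X : MarkovChain ℕ) : Prop where
  birth_pos : ∀ i : ℕ, 0 < X.P i (i + 1)
  death_pos : ∀ i : ℕ, 0 < X.P (i + 1) i
  tridiagonal : ∀ i j : ℕ, 1 < |(i : ℤ) - (j : ℤ)| → X.P i j = 0
  self_pos : ∃ i : ℕ, 0 < X.P i i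

section PathSpace

variable {S : Type}

lemma pathShift_iterate_apply (n : ℕ) (ω : ℕ → S) (k : ℕ) :
    pathShift^[n] ω k = ω (k + n) := by
  induction n generalizing ω with
  | zero => rfl
  | succ n ih => rw [Function.iterate_succ_apply, ih]; exact congrArg ω (by omega)

lemma pathShift_iterate_surjective (n : ℕ) :
    Function.Surjective (pathShift^[n] : (ℕ → S) → ℕ → S) := fun ω =>
  ⟨fun k => ω (k - n), by ext k; simp [pathShift_iterate_apply]⟩

/-- The set of paths that agree with `s` up to time `n`. -/
def pathCylinder (n : ℕ) (s : ℕ → S) : Set (ℕ → S) := {ω | ∀ k ≤ n, ω k = s k}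

lemma exists_pathCylinder_eq (n : ℕ) (a : Finset.Iic n → S) :
    ∃ s : ℕ → S, Preorder.frestrictLe (π := fun _ => S) n ⁻¹' {a} = pathCylinder n s := by
  refine ⟨fun k => if h : k ∈ Finset.Iic n then a ⟨k, h⟩ else a ⟨0, by simp⟩, ?_⟩
  ext ω
  simp only [pathCylinder, mem_preimage, mem_singleton_iff, mem_ofPred_eq, funext_iff]
  constructor
  · intro h k hk
    have := h ⟨k, by simpa using hk⟩
    simpa [hk] using this
  · rintro h ⟨k, hk⟩
    have hk' : k ≤ n := by simpa using hk
    simpa [hk'] using h k hk'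

variable [MeasurableSpace S]

lemma measurable_pathShift_iterate (n : ℕ) :
    Measurable (pathShift^[n] : (ℕ → S) → ℕ → S) := by
  refine measurable_pi_lambda _ fun k => ?_
  simp_rw [pathShift_iterate_apply]
  exact measurable_pi_apply _

variable [MeasurableSingletonClass S]

lemma measurableSet_pathCylinder (n : ℕ) (s : ℕ → S) : MeasurableSet (pathCylinder n s) := by
  have : pathCylinder n s = ⋂ k, ⋂ _ : k ≤ n, (fun ω : ℕ → S => ω k) ⁻¹' {s k} := by
    ext; simp [pathCylinder]
  rw [this]
  exact .iInter fun k => .iInter fun _ => measurable_pi_apply k (measurableSet_singleton _)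

variable [Countable S]

lemma map_frestrictLe_ext {μ ν : Measure (ℕ → S)} (n : ℕ)
    (h : ∀ s, μ (pathCylinder n s) = ν (pathCylinder n s)) :
    μ.map (Preorder.frestrictLe n) = ν.map (Preorder.frestrictLe n) := by
  refine Measure.ext_of_singleton fun a => ?_
  obtain ⟨s, hs⟩ := exists_pathCylinder_eq n a
  rw [Measure.map_apply (Preorder.measurable_frestrictLe n) (measurableSet_singleton a),
    Measure.map_apply (Preorder.measurable_frestrictLe n) (measurableSet_singleton a), hs, h]

lemma measure_ext_pathCylinder {μ ν : Measure (ℕ → S)} [IsFiniteMeasure μ] [IsFiniteMeasure ν]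
    (h : ∀ n s, μ (pathCylinder n s) = ν (pathCylinder n s)) : μ = ν := by
  have key : IsProjectiveLimit μ fun I : Finset ℕ => ν.map I.restrict := by
    rw [isProjectiveLimit_nat_iff]
    · exact fun n => map_frestrictLe_ext n (h n)
    · intro I J hJI
      rw [Measure.map_map (by fun_prop) (by fun_prop)]
      rfl
  have : ∀ I : Finset ℕ, IsFiniteMeasure (ν.map (I.restrict (π := fun _ => S))) := fun I =>
    inferInstance
  exact IsProjectiveLimit.unique key fun I => rfl

lemma measurableSet_of_countable_states (C : Set S) : MeasurableSet C := C.to_countable.measurableSet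

end PathSpace

namespace MarkovChain

variable {S : Type} [MeasurableSpace S] (X : MarkovChain S)

instance : IsProbabilityMeasure X.μ := X.μ_prob

lemma measure_pathCylinder (n : ℕ) (s : ℕ → S) :
    X.μ (pathCylinder n s)
      = ENNReal.ofReal (X.init (s 0) * ∏ k ∈ Finset.range n, X.P (s k) (s (k + 1))) :=
  X.μ_cylinder n s

lemma measure_pathCylinder_inter_shift (n : ℕ) (s : ℕ → S) (K : ℕ) (t : ℕ → S) (h : t 0 = s n) :
    X.μ (pathCylinder n s ∩ pathShift^[n] ⁻¹' pathCylinder K t)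
      = X.μ (pathCylinder n s)
        * ENNReal.ofReal (∏ k ∈ Finset.range K, X.P (t k) (t (k + 1))) := by
  set r : ℕ → S := fun k => if k ≤ n then s k else t (k - n) with hr
  have hr1 : ∀ k ≤ n, r k = s k := fun k hk => by simp [hr, hk]
  have hr2 : ∀ k, r (n + k) = t k := by
    intro k
    rcases Nat.eq_zero_or_pos k with rfl | hk
    · simp [hr, h]
    · have : ¬ n + k ≤ n := by omega
      simp [hr, hk.ne']
  have hset : pathCylinder n s ∩ pathShift^[n] ⁻¹' pathCylinder K t = pathCylinder (n + K) r := by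
    ext ω
    simp only [pathCylinder, mem_inter_iff, mem_preimage, mem_ofPred_eq, pathShift_iterate_apply]
    constructor
    · rintro ⟨h1, h2⟩ k hk
      rcases le_total k n with hkn | hkn
      · rw [h1 k hkn, hr1 k hkn]
      · obtain ⟨j, rfl⟩ := Nat.exists_eq_add_of_le hkn
        rw [hr2, ← h2 j (by omega), add_comm]
    · intro H
      refine ⟨fun k hk => by rw [H k (by omega), hr1 k hk], fun k hk => ?_⟩
      rw [add_comm, H _ (by omega), hr2]
  have hinit := mul_nonneg (X.init_nonneg (s 0)) (Finset.prod_nonneg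
    (s := Finset.range n) fun k _ => X.P_nonneg (s k) (s (k + 1)))
  rw [hset, measure_pathCylinder, measure_pathCylinder, ← ENNReal.ofReal_mul hinit,
    Finset.prod_range_add, ← mul_assoc, hr1 0 (Nat.zero_le n)]
  congr 2
  · congr 1
    refine Finset.prod_congr rfl fun k hk => ?_
    have := Finset.mem_range.1 hk
    rw [hr1 k (by omega), hr1 (k + 1) (by omega)]
  · refine Finset.prod_congr rfl fun k _ => ?_
    rw [add_assoc, hr2, hr2]

lemma measure_pathCylinder_inter_shift_of_ne (n : ℕ) (s : ℕ → S) (K : ℕ) (t : ℕ → S)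
    (h : t 0 ≠ s n) :
    X.μ (pathCylinder n s ∩ pathShift^[n] ⁻¹' pathCylinder K t) = 0 := by
  convert measure_empty (μ := X.μ)
  refine eq_empty_of_forall_notMem fun ω hω => h ?_
  have h1 := hω.1 n le_rfl
  have h2 := hω.2 0 (Nat.zero_le _)
  rw [pathShift_iterate_apply, zero_add] at h2
  rw [← h1, ← h2]

open Classical in
/-- The law of the path of `X` started from `i`, obtained by conditioning on a path of positive
probability that leads to `i`. -/
noncomputable def law (i : S) : Measure (ℕ → S) :=
  if h : ∃ p : ℕ × (ℕ → S), p.2 p.1 = i ∧ X.μ (pathCylinder p.1 p.2) ≠ 0 then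
    (X.μ[|pathCylinder h.choose.1 h.choose.2]).map pathShift^[h.choose.1]
  else 0

lemma law_univ_le_one (i : S) : X.law i univ ≤ 1 := by
  unfold law
  split_ifs with h
  · rw [Measure.map_apply (measurable_pathShift_iterate _) .univ, preimage_univ]
    exact prob_le_one
  · simp

instance (i : S) : IsFiniteMeasure (X.law i) :=
  ⟨(X.law_univ_le_one i).trans_lt ENNReal.one_lt_top⟩

variable [MeasurableSingletonClass S]

/-- The law of the path after time `n`, given the first `n` steps. -/
lemma cond_map_pathCylinder (n : ℕ) (s : ℕ → S) (hs : X.μ (pathCylinder n s) ≠ 0) (K : ℕ)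
    (t : ℕ → S) [Decidable (t 0 = s n)] :
    (X.μ[|pathCylinder n s]).map pathShift^[n] (pathCylinder K t)
      = if t 0 = s n then ENNReal.ofReal (∏ k ∈ Finset.range K, X.P (t k) (t (k + 1))) else 0 := by
  rw [Measure.map_apply (measurable_pathShift_iterate n) (measurableSet_pathCylinder K t),
    cond_apply (measurableSet_pathCylinder n s)]
  split_ifs with h
  · rw [measure_pathCylinder_inter_shift X n s K t h, ← mul_assoc,
      ENNReal.inv_mul_cancel hs (measure_ne_top _ _), one_mul]
  · rw [measure_pathCylinder_inter_shift_of_ne X n s K t h, mul_zero]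

variable [Countable S]

/-- The Markov property. -/
lemma measure_pathCylinder_inter (n : ℕ) (s : ℕ → S) {B : Set (ℕ → S)} (hB : MeasurableSet B) :
    X.μ (pathCylinder n s ∩ pathShift^[n] ⁻¹' B) = X.μ (pathCylinder n s) * X.law (s n) B := by
  classical
  by_cases h0 : X.μ (pathCylinder n s) = 0
  · rw [h0, zero_mul]
    exact measure_mono_null inter_subset_left h0
  have hex : ∃ p : ℕ × (ℕ → S), p.2 p.1 = s n ∧ X.μ (pathCylinder p.1 p.2) ≠ 0 :=
    ⟨(n, s), rfl, h0⟩
  have hlaw : X.law (s n) = (X.μ[|pathCylinder n s]).map pathShift^[n] := by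
    rw [law, dif_pos hex]
    refine measure_ext_pathCylinder fun K t => ?_
    rw [cond_map_pathCylinder X n s h0, cond_map_pathCylinder X _ _ hex.choose_spec.2,
      hex.choose_spec.1]
  rw [hlaw, Measure.map_apply (measurable_pathShift_iterate n) hB,
    cond_apply (measurableSet_pathCylinder n s), ← mul_assoc,
    ENNReal.mul_inv_cancel h0 (measure_ne_top _ _), one_mul]

/-- The conditional probability of a future event given the first `n` steps. -/
lemma condExp_indicator_shift (n : ℕ) {B : Set (ℕ → S)} (hB : MeasurableSet B) :
    X.μ[(pathShift^[n] ⁻¹' B).indicator (fun _ => (1 : ℝ)) |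
        Filtration.piLE (X := fun _ : ℕ => S) n]
      =ᵐ[X.μ] fun ω => (X.law (ω n)).real B := by
  have hmeas : Measurable fun i : S => X.law i B := measurable_of_countable _
  have hmeas' : Measurable fun ω : ℕ → S => X.law (ω n) B := hmeas.comp (measurable_pi_apply n)
  have hBn : MeasurableSet (pathShift^[n] ⁻¹' B) := measurable_pathShift_iterate n hB
  have hle : ∀ i, X.law i B ≤ 1 := fun i => (measure_mono (subset_univ _)).trans (X.law_univ_le_one i)
  have hint : Integrable (fun ω : ℕ → S => (X.law (ω n)).real B) X.μ := by
    refine Integrable.of_bound (C := 1) hmeas'.ennreal_toReal.aestronglyMeasurable ?_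
    refine .of_forall fun ω => ?_
    rw [Real.norm_of_nonneg measureReal_nonneg]
    exact ENNReal.toReal_le_of_le_ofReal zero_le_one (by simpa using hle _)
  have hmap : (X.μ.restrict (pathShift^[n] ⁻¹' B)).map (Preorder.frestrictLe n)
      = (X.μ.withDensity fun ω => X.law (ω n) B).map (Preorder.frestrictLe n) := by
    refine map_frestrictLe_ext n fun s => ?_
    rw [Measure.restrict_apply (measurableSet_pathCylinder n s),
      measure_pathCylinder_inter X n s hB, withDensity_apply _ (measurableSet_pathCylinder n s),
      setLIntegral_congr_fun (g := fun _ => X.law (s n) B) (measurableSet_pathCylinder n s)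
        (fun ω hω => by rw [hω n le_rfl]), setLIntegral_const, mul_comm]
  refine (ae_eq_condExp_of_forall_setIntegral_eq (Filtration.piLE.le n) ?_ ?_ ?_ ?_).symm
  · exact (integrable_const (1 : ℝ)).indicator hBn
  · exact fun A _ _ => hint.integrableOn
  · intro A hA _
    have hA' : MeasurableSet A := Filtration.piLE.le n A hA
    rw [Filtration.piLE_eq_comap_frestrictLe] at hA
    obtain ⟨A', hA'm, rfl⟩ := hA
    have h1 := DFunLike.congr_fun hmap A'
    rw [Measure.map_apply (Preorder.measurable_frestrictLe n) hA'm,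
      Measure.map_apply (Preorder.measurable_frestrictLe n) hA'm,
      Measure.restrict_apply hA', withDensity_apply _ hA'] at h1
    rw [setIntegral_indicator hBn, setIntegral_const, smul_eq_mul, mul_one, measureReal_def, h1,
      integral_eq_lintegral_of_nonneg_ae (.of_forall fun _ => measureReal_nonneg)
        hint.aestronglyMeasurable.restrict]
    congr 1
    refine lintegral_congr fun ω => ?_
    rw [ofReal_measureReal]
  · refine (Measurable.stronglyMeasurable ?_).aestronglyMeasurable
    rw [Filtration.piLE_eq_comap_frestrictLe]
    have : (fun ω : ℕ → S => (X.law (ω n)).real B)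
        = (fun a : Finset.Iic n → S => (X.law (a ⟨n, by simp⟩)).real B)
          ∘ Preorder.frestrictLe n := rfl
    rw [this]
    exact (measurable_of_countable _).comp (comap_measurable _)

lemma iSup_piLE_eq :
    (⨆ n, (Filtration.piLE (X := fun _ : ℕ => S) n : MeasurableSpace (ℕ → S)))
      = MeasurableSpace.pi := by
  refine le_antisymm (iSup_le fun n => Filtration.piLE.le n) (iSup_le fun n => ?_)
  refine le_trans ?_ (le_iSup _ n)
  rw [Filtration.piLE_eq_comap_frestrictLe]
  have : (fun ω : ℕ → S => ω n)
      = (fun a : Finset.Iic n → S => a ⟨n, by simp⟩) ∘ Preorder.frestrictLe n := rfl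
  rw [this, ← MeasurableSpace.comap_comp]
  exact MeasurableSpace.comap_mono (measurable_pi_apply _).comap_le

end MarkovChain

section Invariant

variable {S : Type} {m : ℕ} {E F : Set (ℕ → S)}

namespace MInvariant

lemma preimage_eq (h : MInvariant m E) : pathShift^[m] ⁻¹' E = E := by
  ext ω; exact (h ω).symm

lemma preimage_mul_eq (h : MInvariant m E) (k : ℕ) : pathShift^[k * m] ⁻¹' E = E := by
  induction k with
  | zero => simp
  | succ k ih => rw [Nat.succ_mul, Function.iterate_add, preimage_comp, ih, h.preimage_eq]

lemma shift (h : MInvariant m E) (n : ℕ) : MInvariant m (pathShift^[n] ⁻¹' E) := fun ω => by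
  rw [mem_preimage, mem_preimage, ← Function.iterate_add_apply, add_comm,
    Function.iterate_add_apply]
  exact h _

/-- On `m`-invariant events, the shift by `n` has the shift by `n * m - n` as an inverse. -/
lemma shift_shift (h : MInvariant m E) (hm : 0 < m) (n : ℕ) :
    pathShift^[n * m - n] ⁻¹' (pathShift^[n] ⁻¹' E) = E := by
  rw [← preimage_comp, ← Function.iterate_add,
    Nat.add_sub_cancel' (Nat.le_mul_of_pos_right n hm), h.preimage_mul_eq]

lemma shift_shift' (h : MInvariant m E) (hm : 0 < m) (n : ℕ) :
    pathShift^[n] ⁻¹' (pathShift^[n * m - n] ⁻¹' E) = E := by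
  rw [← preimage_comp, ← Function.iterate_add,
    Nat.sub_add_cancel (Nat.le_mul_of_pos_right n hm), h.preimage_mul_eq]

lemma image_eq (h : MInvariant m E) {n : ℕ} (hn : n ≤ m) :
    pathShift^[n] '' E = pathShift^[m - n] ⁻¹' E := by
  conv_lhs => rw [← h.preimage_eq, ← Nat.sub_add_cancel hn, Function.iterate_add, preimage_comp]
  exact image_preimage_eq _ (pathShift_iterate_surjective n)

end MInvariant

lemma preimage_iterate_add (a b : ℕ) (E : Set (ℕ → S)) :
    pathShift^[a + b] ⁻¹' E = pathShift^[b] ⁻¹' (pathShift^[a] ⁻¹' E) := by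
  rw [Function.iterate_add, preimage_comp]

/-- Measurable `m`-invariant events. -/
structure IsInvariantEvent [MeasurableSpace S] (m : ℕ) (E : Set (ℕ → S)) : Prop where
  measurableSet : MeasurableSet E
  invariant : MInvariant m E

namespace IsInvariantEvent

variable [MeasurableSpace S]

lemma inter (hE : IsInvariantEvent m E) (hF : IsInvariantEvent m F) :
    IsInvariantEvent m (E ∩ F) :=
  ⟨hE.1.inter hF.1, fun ω => and_congr (hE.2 ω) (hF.2 ω)⟩

lemma compl (hE : IsInvariantEvent m E) : IsInvariantEvent m Eᶜ :=
  ⟨hE.1.compl, fun ω => not_congr (hE.2 ω)⟩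

lemma diff (hE : IsInvariantEvent m E) (hF : IsInvariantEvent m F) :
    IsInvariantEvent m (E \ F) := hE.inter hF.compl

lemma shift (hE : IsInvariantEvent m E) (n : ℕ) :
    IsInvariantEvent m (pathShift^[n] ⁻¹' E) :=
  ⟨measurable_pathShift_iterate n hE.1, hE.2.shift n⟩

/-- The paths some shift of which lies in an `m`-invariant event form an invariant event. -/
lemma iUnion_shift (hE : IsInvariantEvent m E) (hm : 0 < m) :
    IsInvariantEvent 1 (⋃ j : ℕ, pathShift^[j] ⁻¹' E) := by
  refine ⟨.iUnion fun j => (hE.shift j).1, fun ω => ?_⟩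
  simp only [mem_iUnion, mem_preimage]
  constructor
  · rintro ⟨j, hj⟩
    cases j with
    | zero =>
      refine ⟨m - 1, ?_⟩
      rw [← Function.iterate_add_apply, Nat.sub_add_cancel hm]
      exact (hE.2 ω).1 hj
    | succ j => exact ⟨j, by rwa [← Function.iterate_add_apply]⟩
  · rintro ⟨j, hj⟩
    exact ⟨j + 1, by rwa [Function.iterate_add_apply]⟩

lemma iUnion_shift_eq (hE : IsInvariantEvent m E) (hm : 0 < m) :
    ⋃ j : ℕ, pathShift^[j] ⁻¹' E = ⋃ j ∈ Finset.range m, pathShift^[j] ⁻¹' E := by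
  ext ω
  simp only [mem_iUnion, Finset.mem_range, exists_prop]
  constructor
  · rintro ⟨j, hj⟩
    refine ⟨j % m, Nat.mod_lt _ hm, ?_⟩
    rwa [← Nat.div_add_mod j m, mul_comm, preimage_iterate_add, hE.2.preimage_mul_eq] at hj
  · rintro ⟨j, -, hj⟩
    exact ⟨j, hj⟩

end IsInvariantEvent

end Invariant

namespace MarkovChain

section Sets

variable {S : Type} [MeasurableSpace S] (X : MarkovChain S) {m : ℕ} {A B C : Set S}

lemma L_subset_U (m : ℕ) (C : Set S) : X.L m C ⊆ X.U m C := by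
  rintro ω ⟨N, hN⟩ n
  exact ⟨max n N, le_max_left _ _, hN _ (le_max_right _ _)⟩

lemma L_mono (h : A ⊆ B) : X.L m A ⊆ X.L m B := fun _ ⟨n, hn⟩ => ⟨n, fun k hk => h (hn k hk)⟩

lemma U_mono (h : A ⊆ B) : X.U m A ⊆ X.U m B := fun _ hω n =>
  let ⟨k, hk, hkA⟩ := hω n
  ⟨k, hk, h hkA⟩

lemma L_inter (m : ℕ) (A B : Set S) : X.L m (A ∩ B) = X.L m A ∩ X.L m B := by
  refine Subset.antisymm
    (subset_inter (X.L_mono inter_subset_left) (X.L_mono inter_subset_right)) ?_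
  rintro ω ⟨⟨a, ha⟩, ⟨b, hb⟩⟩
  exact ⟨max a b, fun k hk =>
    ⟨ha k ((le_max_left _ _).trans hk), hb k ((le_max_right _ _).trans hk)⟩⟩

lemma disjoint_L (h : Disjoint A B) : Disjoint (X.L m A) (X.L m B) := by
  rw [disjoint_iff_inter_eq_empty, ← L_inter, disjoint_iff_inter_eq_empty.1 h]
  exact eq_empty_of_forall_notMem fun ω ⟨n, hn⟩ => hn n le_rfl

lemma U_subset_U_one (hm : 0 < m) : X.U m C ⊆ X.U 1 C := fun ω hω n =>
  let ⟨k, hk, hkC⟩ := hω n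
  ⟨k * m, hk.trans (Nat.le_mul_of_pos_right k hm), by rwa [mul_one]⟩

lemma L_one_subset_L (hm : 0 < m) : X.L 1 C ⊆ X.L m C := fun ω ⟨n, hn⟩ =>
  ⟨n, fun k hk => by
    simpa using hn (k * m) (hk.trans (Nat.le_mul_of_pos_right k hm))⟩

lemma L_invariant (m : ℕ) (C : Set S) : MInvariant m (X.L m C) := fun ω => by
  simp only [L, mem_ofPred_eq, pathShift_iterate_apply, ← Nat.succ_mul]
  constructor
  · rintro ⟨n, hn⟩
    exact ⟨n, fun k hk => hn _ (by omega)⟩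
  · rintro ⟨n, hn⟩
    refine ⟨n + 1, fun k hk => ?_⟩
    have := hn (k - 1) (by omega)
    rwa [Nat.succ_eq_add_one, Nat.sub_add_cancel (by omega)] at this

lemma regular_iff : X.Regular m C ↔ X.U m C =ᵐ[X.μ] X.L m C := measure_symmDiff_eq_zero_iff

variable {X} in
lemma AlmostClosed.ae_eq (h : X.AlmostClosed m C) : X.U m C =ᵐ[X.μ] X.L m C := X.regular_iff.1 h.1

variable {X} in
lemma AlmostClosed.measure_L_ne_zero (h : X.AlmostClosed m C) : X.μ (X.L m C) ≠ 0 := fun h0 =>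
  h.2 ((measure_congr h.ae_eq).trans h0)

lemma almostClosed_of_le (hUL : X.U m C ≤ᵐ[X.μ] X.L m C) (h0 : X.μ (X.L m C) ≠ 0) :
    X.AlmostClosed m C :=
  ⟨X.regular_iff.2 (hUL.antisymm (X.L_subset_U m C).eventuallyLE),
    fun h => h0 (measure_mono_null (X.L_subset_U m C) h)⟩

variable {X} in
lemma AlmostClosed.inter (hA : X.AlmostClosed m A) (hB : X.AlmostClosed m B)
    (h : X.μ (X.L m A ∩ X.L m B) ≠ 0) : X.AlmostClosed m (A ∩ B) := by
  refine X.almostClosed_of_le ?_ (by rwa [L_inter])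
  rw [L_inter]
  have : X.U m (A ∩ B) ⊆ X.U m A ∩ X.U m B :=
    subset_inter (X.U_mono inter_subset_left) (X.U_mono inter_subset_right)
  exact this.eventuallyLE.trans (hA.ae_eq.inter hB.ae_eq).le

variable {X} in
lemma AlmostClosed.of_one (hC : X.AlmostClosed 1 C) (hm : 0 < m) : X.AlmostClosed m C := by
  refine X.almostClosed_of_le ?_ fun h =>
    hC.measure_L_ne_zero (measure_mono_null (X.L_one_subset_L hm) h)
  exact (X.U_subset_U_one hm).eventuallyLE.trans
    (hC.ae_eq.le.trans (X.L_one_subset_L hm).eventuallyLE)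

variable {X} in
lemma Atomic.of_subset (hC : X.Atomic m C) (hA : X.AlmostClosed m A) (h : A ⊆ C) :
    X.Atomic m A :=
  ⟨hA, fun ⟨D, D', hD, hD', hdisj, h1, h2⟩ =>
    hC.2 ⟨D, D', hD.trans h, hD'.trans h, hdisj, h1, h2⟩⟩

lemma almostClosed_univ (m : ℕ) : X.AlmostClosed m univ := by
  have : X.L m univ = univ := eq_univ_of_forall fun ω => ⟨0, fun _ _ => mem_univ _⟩
  exact X.almostClosed_of_le (by rw [this]; exact (subset_univ _).eventuallyLE) (by simp [this])

variable [MeasurableSingletonClass S] [Countable S]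

lemma measurableSet_L (m : ℕ) (C : Set S) : MeasurableSet (X.L m C) := by
  have : X.L m C = ⋃ n : ℕ, ⋂ k : ℕ, ⋂ _ : n ≤ k, (fun ω : ℕ → S => ω (k * m)) ⁻¹' C := by
    ext; simp [L]
  rw [this]
  exact .iUnion fun n => .iInter fun k => .iInter fun _ =>
    measurable_pi_apply (k * m) (measurableSet_of_countable_states C)

lemma isInvariantEvent_L (m : ℕ) (C : Set S) : IsInvariantEvent m (X.L m C) :=
  ⟨X.measurableSet_L m C, X.L_invariant m C⟩

end Sets

section Paths

variable {S : Type} [MeasurableSpace S] (X : MarkovChain S)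

/-- There is a path of length `n` from `i` to `j` all of whose steps have positive probability. -/
def HasPath (n : ℕ) (i j : S) : Prop :=
  ∃ s : ℕ → S, s 0 = i ∧ s n = j ∧ ∀ k < n, 0 < X.P (s k) (s (k + 1))

variable {X}

lemma HasPath.trans {a b : ℕ} {i j k : S} (h₁ : X.HasPath a i j) (h₂ : X.HasPath b j k) :
    X.HasPath (a + b) i k := by
  obtain ⟨s, hs0, hsa, hs⟩ := h₁
  obtain ⟨t, ht0, htb, ht⟩ := h₂
  have hr : ∀ c, (if a + c ≤ a then s (a + c) else t (a + c - a)) = t c := by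
    intro c
    rcases Nat.eq_zero_or_pos c with rfl | hc
    · simp [hsa, ht0]
    · simp [hc.ne']
  refine ⟨fun l => if l ≤ a then s l else t (l - a), by simp [hs0], (hr b).trans htb,
    fun l hl => ?_⟩
  rcases lt_or_ge l a with hla | hla
  · simpa [hla.le, Nat.succ_le_of_lt hla] using hs l hla
  · obtain ⟨c, rfl⟩ := Nat.exists_eq_add_of_le hla
    simp only [hr, add_assoc]
    exact ht c (by omega)

lemma hasPath_one {i j : S} (h : 0 < X.P i j) : X.HasPath 1 i j :=
  ⟨fun k => if k = 0 then i else j, by simp, by simp, fun k hk => by simpa [Nat.lt_one_iff.1 hk]⟩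

lemma Pn_nonneg (n : ℕ) (i j : S) : 0 ≤ X.Pn n i j := by
  induction n generalizing j with
  | zero => unfold Pn; split_ifs <;> norm_num
  | succ n ih => exact tsum_nonneg fun k => mul_nonneg (ih k) (X.P_nonneg k j)

lemma hasPath_of_Pn_pos {n : ℕ} {i j : S} (h : 0 < X.Pn n i j) : X.HasPath n i j := by
  induction n generalizing j with
  | zero =>
    unfold Pn at h
    split_ifs at h with hij
    · exact ⟨fun _ => i, rfl, hij, by simp⟩
    · exact absurd h (lt_irrefl _)
  | succ n ih =>
    obtain ⟨k, hk⟩ : ∃ k, X.Pn n i k * X.P k j ≠ 0 := by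
      by_contra! H
      exact h.ne' (by simp [Pn, H])
    exact (ih ((Pn_nonneg n i k).lt_of_ne' (left_ne_zero_of_mul hk))).trans
      (hasPath_one ((X.P_nonneg k j).lt_of_ne' (right_ne_zero_of_mul hk)))

lemma eventually_hasPath (hirr : X.Irreducible) (hap : X.Aperiodic) (i j : S) :
    ∃ N, ∀ n ≥ N, X.HasPath n i j := by
  set R : Set ℕ := {n | 0 < n ∧ X.HasPath n j j}
  obtain ⟨a, ha⟩ := hirr i j
  obtain ⟨N, hN⟩ := Nat.exists_mem_closure_of_ge R
  have hgcd : Nat.setGcd R = 1 := hap j _ fun n hn hpos =>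
    Nat.setGcd_dvd_of_mem ⟨hn, hasPath_of_Pn_pos hpos⟩
  have hclosure : ∀ n ∈ AddSubmonoid.closure R, X.HasPath n j j := fun n hn => by
    induction hn using AddSubmonoid.closure_induction with
    | mem n hn => exact hn.2
    | zero => exact ⟨fun _ => j, rfl, rfl, by simp⟩
    | add a b _ _ ha hb => exact ha.trans hb
  refine ⟨a + N, fun n hn => ?_⟩
  have := (hasPath_of_Pn_pos ha).trans
    (hclosure (n - a) (hN (n - a) (by omega) (by rw [hgcd]; exact one_dvd _)))
  rwa [Nat.add_sub_cancel' (by omega)] at this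

variable (X) in
lemma exists_init_pos : ∃ i, 0 < X.init i := by
  by_contra! H
  have : X.init = 0 := funext fun i => le_antisymm (H i) (X.init_nonneg i)
  have h := X.init_hasSum
  rw [this] at h
  exact zero_ne_one (hasSum_zero.unique h)

variable [MeasurableSingletonClass S] [Countable S] {m : ℕ} {E F : Set (ℕ → S)}

lemma law_eq_zero (hirr : X.Irreducible) (hap : X.Aperiodic) (hm : 0 < m)
    (hE : IsInvariantEvent m E) (h0 : X.μ E = 0) (i : S) : X.law i E = 0 := by
  obtain ⟨i₀, hi₀⟩ := X.exists_init_pos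
  obtain ⟨N, hN⟩ := eventually_hasPath hirr hap i₀ i
  obtain ⟨s, hs0, hsi, hs⟩ := hN (N * m) (Nat.le_mul_of_pos_right N hm)
  have h1 := X.measure_pathCylinder_inter (N * m) s hE.1
  rw [hE.2.preimage_mul_eq, measure_mono_null inter_subset_right h0, hsi, eq_comm,
    mul_eq_zero] at h1
  refine h1.resolve_left ?_
  rw [measure_pathCylinder, hs0]
  refine (ENNReal.ofReal_pos.2 ?_).ne'
  exact mul_pos hi₀ (Finset.prod_pos fun k hk => hs k (Finset.mem_range.1 hk))

lemma measure_shift_eq_zero_of_law (h : ∀ i, X.law i E = 0) (hE : MeasurableSet E) (n : ℕ) :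
    X.μ (pathShift^[n] ⁻¹' E) = 0 := by
  refine measure_mono_null (t := ⋃ a : Finset.Iic n → S,
    Preorder.frestrictLe (π := fun _ => S) n ⁻¹' {a} ∩ pathShift^[n] ⁻¹' E)
    (fun ω hω => mem_iUnion.2 ⟨Preorder.frestrictLe n ω, rfl, hω⟩) ?_
  refine measure_iUnion_null fun a => ?_
  obtain ⟨s, hs⟩ := exists_pathCylinder_eq n a
  rw [hs, measure_pathCylinder_inter X n s hE, h, mul_zero]

lemma measure_shift_eq_zero_iff (hirr : X.Irreducible) (hap : X.Aperiodic) (hm : 0 < m)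
    (hE : IsInvariantEvent m E) (n : ℕ) : X.μ (pathShift^[n] ⁻¹' E) = 0 ↔ X.μ E = 0 := by
  have key : ∀ (F : Set (ℕ → S)) (k : ℕ), IsInvariantEvent m F → X.μ F = 0 →
      X.μ (pathShift^[k] ⁻¹' F) = 0 := fun F k hF h0 =>
    measure_shift_eq_zero_of_law (law_eq_zero hirr hap hm hF h0) hF.1 k
  refine ⟨fun h => ?_, key E n hE⟩
  rw [← hE.2.shift_shift hm n]
  exact key _ _ (hE.shift n) h

lemma shift_ae_le (hirr : X.Irreducible) (hap : X.Aperiodic) (hm : 0 < m)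
    (hE : IsInvariantEvent m E) (hF : IsInvariantEvent m F) (h : E ≤ᵐ[X.μ] F) (n : ℕ) :
    (pathShift^[n] ⁻¹' E : Set (ℕ → S)) ≤ᵐ[X.μ] pathShift^[n] ⁻¹' F := by
  rw [ae_le_set] at h ⊢
  exact (measure_shift_eq_zero_iff hirr hap hm (hE.diff hF) n).2 h

lemma shift_ae_eq (hirr : X.Irreducible) (hap : X.Aperiodic) (hm : 0 < m)
    (hE : IsInvariantEvent m E) (hF : IsInvariantEvent m F) (h : E =ᵐ[X.μ] F) (n : ℕ) :
    (pathShift^[n] ⁻¹' E : Set (ℕ → S)) =ᵐ[X.μ] pathShift^[n] ⁻¹' F :=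
  (shift_ae_le hirr hap hm hE hF h.le n).antisymm (shift_ae_le hirr hap hm hF hE h.symm.le n)

end Paths

section Core

variable {S : Type} [MeasurableSpace S] (X : MarkovChain S)

/-- The states from which the event `E` has probability more than one half. -/
def core (E : Set (ℕ → S)) : Set S := {i | 1 / 2 < (X.law i).real E}

variable [MeasurableSingletonClass S] [Countable S] {m : ℕ} {E F : Set (ℕ → S)}

lemma tendsto_law (hm : 0 < m) (hE : IsInvariantEvent m E) :
    ∀ᵐ ω ∂X.μ, Tendsto (fun k => (X.law (ω (k * m))).real E) atTop
      (nhds (E.indicator (fun _ => (1 : ℝ)) ω)) := by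
  have hlevy := tendsto_ae_condExp (μ := X.μ) (ℱ := Filtration.piLE (X := fun _ : ℕ => S))
    (E.indicator fun _ => (1 : ℝ))
  rw [iSup_piLE_eq, condExp_of_stronglyMeasurable le_rfl
    ((stronglyMeasurable_const).indicator hE.1)
    ((integrable_const (1 : ℝ)).indicator hE.1)] at hlevy
  have hk : ∀ᵐ ω ∂X.μ, ∀ k : ℕ,
      (X.μ[E.indicator (fun _ => (1 : ℝ)) | Filtration.piLE (X := fun _ : ℕ => S) (k * m)]) ω
        = (X.law (ω (k * m))).real E := ae_all_iff.2 fun k => by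
    have := X.condExp_indicator_shift (k * m) hE.1
    rwa [hE.2.preimage_mul_eq] at this
  filter_upwards [hlevy, hk] with ω h1 h2
  refine (h1.comp (tendsto_id.atTop_mul_const' hm)).congr fun k => ?_
  simpa using h2 k

lemma L_core_ae_eq (hm : 0 < m) (hE : IsInvariantEvent m E) : X.L m (X.core E) =ᵐ[X.μ] E := by
  rw [eventuallyEq_set]
  filter_upwards [X.tendsto_law hm hE] with ω hω
  by_cases hωE : ω ∈ E
  · rw [indicator_of_mem hωE] at hω
    exact iff_of_true (eventually_atTop.1 (hω.eventually (lt_mem_nhds (by norm_num)))) hωE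
  · rw [indicator_of_notMem hωE] at hω
    refine iff_of_false (fun ⟨n, hn⟩ => ?_) hωE
    obtain ⟨N, hN⟩ := eventually_atTop.1
      (hω.eventually (gt_mem_nhds (show (0 : ℝ) < 1 / 2 by norm_num)))
    exact lt_asymm (hN _ (le_max_right n N)) (hn _ (le_max_left n N))

lemma U_core_ae_le (hm : 0 < m) (hE : IsInvariantEvent m E) : X.U m (X.core E) ≤ᵐ[X.μ] E := by
  filter_upwards [X.tendsto_law hm hE] with ω hω hU
  by_contra hωE
  rw [indicator_of_notMem hωE] at hω
  obtain ⟨N, hN⟩ := eventually_atTop.1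
    (hω.eventually (gt_mem_nhds (show (0 : ℝ) < 1 / 2 by norm_num)))
  obtain ⟨k, hk, hkE⟩ := hU N
  exact lt_asymm (hN _ hk) hkE

lemma almostClosed_core (hm : 0 < m) (hE : IsInvariantEvent m E) (h0 : X.μ E ≠ 0) :
    X.AlmostClosed m (X.core E) := by
  refine X.almostClosed_of_le ((X.U_core_ae_le hm hE).trans (X.L_core_ae_eq hm hE).symm.le) ?_
  rwa [measure_congr (X.L_core_ae_eq hm hE)]

variable {X} in
lemma disjoint_core (hirr : X.Irreducible) (hap : X.Aperiodic) (hm : 0 < m)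
    (hE : IsInvariantEvent m E) (hF : IsInvariantEvent m F) (h : X.μ (E ∩ F) = 0) :
    Disjoint (X.core E) (X.core F) := by
  rw [Set.disjoint_left]
  intro i hiE hiF
  have h0 : (X.law i).real (E ∩ F) = 0 := by
    rw [measureReal_def, law_eq_zero hirr hap hm (hE.inter hF) h i, ENNReal.toReal_zero]
  have h1 := measureReal_union_add_inter (μ := X.law i) (s := E) hF.1
  have h2 : (X.law i).real (E ∪ F) ≤ 1 := by
    refine ENNReal.toReal_le_of_le_ofReal zero_le_one ?_
    simpa using (measure_mono (subset_univ _)).trans (X.law_univ_le_one i)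
  simp only [core, mem_ofPred_eq] at hiE hiF
  linarith

end Core

end MarkovChain

namespace MarkovChain

section Atoms

variable {S : Type} [MeasurableSpace S] (X : MarkovChain S)

/-- Atoms of the `m`-invariant measure algebra. -/
structure IsAtomEvent (m : ℕ) (E : Set (ℕ → S)) : Prop extends IsInvariantEvent m E where
  measure_ne_zero : X.μ E ≠ 0
  inter_or_diff : ∀ F, IsInvariantEvent m F → X.μ (E ∩ F) = 0 ∨ X.μ (E \ F) = 0

variable {X} {m : ℕ} {E F : Set (ℕ → S)}

lemma IsAtomEvent.ae_le (hE : X.IsAtomEvent m E) (hF : IsInvariantEvent m F)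
    (h : X.μ (E ∩ F) ≠ 0) : E ≤ᵐ[X.μ] F :=
  ae_le_set.2 ((hE.inter_or_diff F hF).resolve_left h)

lemma IsAtomEvent.ae_eq (hE : X.IsAtomEvent m E) (hF : X.IsAtomEvent m F)
    (h : X.μ (E ∩ F) ≠ 0) : E =ᵐ[X.μ] F :=
  (hE.ae_le hF.1 h).antisymm (hF.ae_le hE.1 (by rwa [inter_comm]))

lemma Atomic.of_L_ae_eq {C : Set S} [MeasurableSingletonClass S] [Countable S]
    (hC : X.AlmostClosed m C) (hE : X.IsAtomEvent m E) (h : X.L m C =ᵐ[X.μ] E) :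
    X.Atomic m C := by
  refine ⟨hC, fun ⟨A, B, hAC, hBC, hdisj, hA, hB⟩ => ?_⟩
  have hle : ∀ D ⊆ C, X.L m D ≤ᵐ[X.μ] E := fun D hD => (X.L_mono hD).eventuallyLE.trans h.le
  have hEA : E ≤ᵐ[X.μ] X.L m A := by
    refine hE.ae_le (X.isInvariantEvent_L m A) fun h0 => hA.measure_L_ne_zero ?_
    have hA' : X.L m A ≤ᵐ[X.μ] (E ∩ X.L m A : Set (ℕ → S)) :=
      (hle A hAC).mono fun ω h hω => ⟨h hω, hω⟩
    exact nonpos_iff_eq_zero.1 ((measure_mono_ae hA').trans h0.le)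
  refine hB.measure_L_ne_zero ?_
  have h1 := ae_le_set.1 ((hle B hBC).trans hEA)
  rwa [(X.disjoint_L hdisj).symm.sdiff_eq_left] at h1

variable [MeasurableSingletonClass S] [Countable S]

lemma IsAtomEvent.shift (hirr : X.Irreducible) (hap : X.Aperiodic) (hm : 0 < m)
    (hE : X.IsAtomEvent m E) (n : ℕ) : X.IsAtomEvent m (pathShift^[n] ⁻¹' E) := by
  refine ⟨hE.1.shift n, (measure_shift_eq_zero_iff hirr hap hm hE.1 n).not.2 hE.2, fun F hF => ?_⟩
  have hG := hF.shift (n * m - n)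
  rw [← hF.2.shift_shift' hm n, ← preimage_inter, ← preimage_sdiff,
    measure_shift_eq_zero_iff hirr hap hm (hE.1.inter hG),
    measure_shift_eq_zero_iff hirr hap hm (hE.1.diff hG)]
  exact hE.3 _ hG

/-- If the state space is atomic, the invariant measure algebra is trivial. -/
lemma Atomic.measure_compl_eq_zero (hirr : X.Irreducible) (hap : X.Aperiodic)
    (hX : X.Atomic 1 univ) (hE : IsInvariantEvent 1 E) (h0 : X.μ E ≠ 0) : X.μ Eᶜ = 0 := by
  by_contra h1
  exact hX.2 ⟨X.core E, X.core Eᶜ, subset_univ _, subset_univ _,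
    disjoint_core hirr hap one_pos hE hE.compl (by simp),
    X.almostClosed_core one_pos hE h0, X.almostClosed_core one_pos hE.compl h1⟩

lemma Atomic.measure_compl_iUnion_shift (hirr : X.Irreducible) (hap : X.Aperiodic)
    (hX : X.Atomic 1 univ) (hm : 0 < m) (hE : IsInvariantEvent m E) (h0 : X.μ E ≠ 0) :
    X.μ (⋃ j : ℕ, pathShift^[j] ⁻¹' E)ᶜ = 0 := by
  refine hX.measure_compl_eq_zero hirr hap (hE.iUnion_shift hm) fun h => h0 ?_
  exact measure_mono_null (subset_iUnion (fun j : ℕ => pathShift^[j] ⁻¹' E) 0) h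

lemma Atomic.one_le_sum_measure_shift (hirr : X.Irreducible) (hap : X.Aperiodic)
    (hX : X.Atomic 1 univ) (hm : 0 < m) (hE : IsInvariantEvent m E) (h0 : X.μ E ≠ 0) :
    1 ≤ ∑ j ∈ Finset.range m, X.μ (pathShift^[j] ⁻¹' E) := by
  rw [← (prob_compl_eq_zero_iff (hE.iUnion_shift hm).1).1
    (hX.measure_compl_iUnion_shift hirr hap hm hE h0), hE.iUnion_shift_eq hm]
  exact measure_biUnion_finset_le _ _

lemma Atomic.exists_isAtomEvent (hirr : X.Irreducible) (hap : X.Aperiodic)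
    (hX : X.Atomic 1 univ) (hm : 0 < m) : ∃ E, X.IsAtomEvent m E := by
  set w : Set (ℕ → S) → ENNReal := fun E => ∑ j ∈ Finset.range m, X.μ (pathShift^[j] ⁻¹' E)
    with hw
  set W : Set ENNReal := w '' {E | IsInvariantEvent m E ∧ X.μ E ≠ 0} with hW
  have huniv : IsInvariantEvent m (univ : Set (ℕ → S)) := ⟨.univ, fun _ => by simp⟩
  have hmem : w univ ∈ W := ⟨univ, ⟨huniv, by simp⟩, rfl⟩
  have htop : sInf W ≠ ⊤ := by
    refine ((sInf_le hmem).trans_lt ?_).ne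
    simp [hw]
  obtain ⟨_, ⟨E, ⟨hE, hE0⟩, rfl⟩, hlt⟩ := exists_lt_of_csInf_lt ⟨_, hmem⟩
    (ENNReal.lt_add_right htop one_ne_zero)
  refine ⟨E, hE, hE0, fun F hF => ?_⟩
  by_contra! hcon
  refine hlt.not_ge ?_
  have hsplit : w E = w (E ∩ F) + w (E \ F) := by
    simp only [hw, ← Finset.sum_add_distrib, preimage_inter, preimage_sdiff]
    exact Finset.sum_congr rfl fun j _ => (measure_inter_add_sdiff _ (hF.shift j).1).symm
  rw [hsplit]
  exact add_le_add (sInf_le ⟨_, ⟨hE.inter hF, hcon.1⟩, rfl⟩)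
    (hX.one_le_sum_measure_shift hirr hap hm (hE.diff hF) hcon.2)

/-- The atoms of the `m`-invariant measure algebra of a chain with atomic state space are
permuted cyclically by the shift. -/
lemma Atomic.exists_cyclic_atoms (hirr : X.Irreducible) (hap : X.Aperiodic)
    (hX : X.Atomic 1 univ) (hm : 0 < m) :
    ∃ (b : ℕ) (E : ℕ → Set (ℕ → S)), b ∣ m ∧ (∀ i < b, X.IsAtomEvent m (E i)) ∧
      (∀ i < b, ∀ j < b, i ≠ j → X.μ (E i ∩ E j) = 0) ∧
      X.μ (⋃ i ∈ Iio b, E i)ᶜ = 0 ∧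
      ∀ i < b, E i =ᵐ[X.μ] pathShift^[1] ⁻¹' E ((i + 1) % b) := by
  classical
  obtain ⟨E, hE⟩ := hX.exists_isAtomEvent hirr hap hm
  have hex : ∃ n, 0 < n ∧ (pathShift^[n] ⁻¹' E : Set (ℕ → S)) =ᵐ[X.μ] E :=
    ⟨m, hm, .of_eq hE.invariant.preimage_eq⟩
  set b := Nat.find hex with hb
  obtain ⟨hb0, hbE⟩ : 0 < b ∧ (pathShift^[b] ⁻¹' E : Set (ℕ → S)) =ᵐ[X.μ] E := Nat.find_spec hex
  have hmin : ∀ r < b, (pathShift^[r] ⁻¹' E : Set (ℕ → S)) =ᵐ[X.μ] E → r = 0 := fun r hr h =>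
    Nat.eq_zero_of_not_pos fun h0 => Nat.find_min hex hr ⟨h0, h⟩
  have hmul : ∀ q, (pathShift^[b * q] ⁻¹' E : Set (ℕ → S)) =ᵐ[X.μ] E := fun q => by
    induction q with
    | zero => rfl
    | succ q ih =>
      rw [Nat.mul_succ, preimage_iterate_add]
      exact (shift_ae_eq hirr hap hm (hE.1.shift _) hE.1 ih b).trans hbE
  have hmod : ∀ n, (pathShift^[n] ⁻¹' E : Set (ℕ → S)) =ᵐ[X.μ] pathShift^[n % b] ⁻¹' E := fun n => by
    conv_lhs => rw [← Nat.div_add_mod n b, preimage_iterate_add]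
    exact shift_ae_eq hirr hap hm (hE.1.shift _) hE.1 (hmul _) _
  have hdvd : b ∣ m := by
    refine Nat.dvd_of_mod_eq_zero (hmin _ (Nat.mod_lt _ hb0) ?_)
    have := hmod m
    rw [hE.invariant.preimage_eq] at this
    exact this.symm
  have hdisj : ∀ i j, i < j → j < b →
      X.μ (pathShift^[b - i] ⁻¹' E ∩ pathShift^[b - j] ⁻¹' E) = 0 := fun i j hij hj => by
    have h1 : b - i = (j - i) + (b - j) := by omega
    rw [h1, preimage_iterate_add, ← preimage_inter,
      measure_shift_eq_zero_iff hirr hap hm ((hE.1.shift _).inter hE.1)]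
    by_contra h0
    have := hmin (j - i) (by omega) ((hE.shift hirr hap hm _).ae_eq hE h0)
    omega
  refine ⟨b, fun i => pathShift^[b - i] ⁻¹' E, hdvd, fun i _ => hE.shift hirr hap hm _, ?_, ?_, ?_⟩
  · intro i hi j hj hij
    rcases hij.lt_or_gt with h | h
    · exact hdisj i j h hj
    · rw [inter_comm]; exact hdisj j i h hi
  · rw [← nonpos_iff_eq_zero,
      ← hX.measure_compl_iUnion_shift hirr hap hm hE.1 hE.measure_ne_zero]
    refine measure_mono_ae (EventuallyLE.compl ?_)
    have : ∀ n : ℕ, (pathShift^[n] ⁻¹' E : Set (ℕ → S)) ≤ᵐ[X.μ]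
        (⋃ i ∈ Iio b, pathShift^[b - i] ⁻¹' E : Set (ℕ → S)) := fun n => by
      rcases Nat.eq_zero_or_pos (n % b) with h | h
      · refine ((hmod n).trans ?_).le.trans
          (subset_biUnion_of_mem (u := fun i => pathShift^[b - i] ⁻¹' E)
            (show 0 ∈ Iio b from hb0)).eventuallyLE
        rw [h]
        exact hbE.symm
      · have hlt := Nat.mod_lt n hb0
        refine (hmod n).le.trans (LE.le.eventuallyLE ?_)
        have := subset_biUnion_of_mem (u := fun i => (pathShift^[b - i] ⁻¹' E : Set (ℕ → S)))
            (show b - n % b ∈ Iio b by simp only [mem_Iio]; omega)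
        rwa [show b - (b - n % b) = n % b by omega] at this
    filter_upwards [ae_all_iff.2 this] with ω hω hωU
    obtain ⟨n, hn⟩ := mem_iUnion.1 hωU
    exact hω n hn
  · intro i hi
    dsimp only
    rw [← preimage_iterate_add]
    rcases (Nat.succ_le_of_lt hi).lt_or_eq with h | h
    · rw [Nat.mod_eq_of_lt h, show b - (i + 1) + 1 = b - i by omega]
      exact .rfl
    · rw [show i + 1 = b from h, Nat.mod_self, show b - i = 1 by omega, Nat.sub_zero,
        preimage_iterate_add]
      exact (shift_ae_eq hirr hap hm (hE.1.shift _) hE.1 hbE 1).symm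

end Atoms

end MarkovChain

namespace MarkovChain

section Blackwell

variable {S : Type} [MeasurableSpace S] {X : MarkovChain S} {m : ℕ}

lemma IsBlackwell.nonempty {𝒞 : Set (Set S)} (h : X.IsBlackwell m 𝒞) : 𝒞.Nonempty := by
  rw [nonempty_iff_ne_empty]
  rintro rfl
  simpa using h.sum_L_eq_one

lemma one_le_beta : 1 ≤ X.beta m := by
  refine le_sInf ?_
  rintro _ ⟨𝒞, h𝒞, rfl⟩
  exact one_le_encard_iff_nonempty.2 (IsBlackwell.nonempty h𝒞)

lemma Simple.exists_isBlackwell (h : X.Simple) : ∃ C, X.IsBlackwell 1 {C} := by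
  have hne : (encard '' {𝒞 : Set (Set S) | X.IsBlackwell 1 𝒞}).Nonempty := by
    rw [nonempty_iff_ne_empty]
    intro hempty
    rw [Simple, beta, hempty, sInf_empty] at h
    exact absurd h (by simp)
  obtain ⟨𝒞, h𝒞, hcard⟩ := csInf_mem hne
  obtain ⟨C, rfl⟩ := encard_eq_one.1 (hcard.trans h)
  exact ⟨C, h𝒞⟩

variable [MeasurableSingletonClass S] [Countable S]

lemma tsum_measure_L {𝒞 : Set (Set S)} (hc : 𝒞.Countable) (hd : 𝒞.PairwiseDisjoint id) :
    ∑' C : 𝒞, X.μ (X.L m (C : Set S)) = X.μ (⋃ C ∈ 𝒞, X.L m C) :=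
  (measure_biUnion hc (fun A hA B hB hAB => X.disjoint_L (hd hA hB hAB))
    fun C _ => X.measurableSet_L m C).symm

lemma IsBlackwell.measure_iUnion_L {𝒞 : Set (Set S)} (h : X.IsBlackwell m 𝒞) :
    X.μ (⋃ C ∈ 𝒞, X.L m C) = 1 := by
  rw [← tsum_measure_L h.countable h.disjoint, h.sum_L_eq_one]

/-- If the `m`-step chain has an atomic set, so does the chain itself. -/
lemma Atomic.exists_atomic_one {A C : Set S} (hirr : X.Irreducible) (hap : X.Aperiodic)
    (hm : 0 < m) (hA : X.Atomic m A) (hC : X.AlmostClosed 1 C) (hC1 : X.μ (X.L 1 C) = 1) :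
    ∃ D ⊆ C, X.Atomic 1 D := by
  set E := X.L m A with hE
  have hEinv : IsInvariantEvent m E := X.isInvariantEvent_L m A
  set F : Set (ℕ → S) := ⋃ j : ℕ, pathShift^[j] ⁻¹' E with hF
  have hFinv : IsInvariantEvent 1 F := hEinv.iUnion_shift hm
  have hEF : E ⊆ F := subset_iUnion (fun j : ℕ => pathShift^[j] ⁻¹' E) 0
  have hF0 : X.μ F ≠ 0 := fun h => hA.1.measure_L_ne_zero (measure_mono_null hEF h)
  have hcore := X.almostClosed_core one_pos hFinv hF0
  have hLcore := X.L_core_ae_eq one_pos hFinv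
  have hLC : X.L 1 C =ᵐ[X.μ] univ := by
    rw [ae_eq_univ, prob_compl_eq_zero_iff (X.measurableSet_L 1 C), hC1]
  have hinter : (X.L 1 (X.core F) ∩ X.L 1 C : Set (ℕ → S)) =ᵐ[X.μ] F := by
    simpa using hLcore.inter hLC
  refine ⟨X.core F ∩ C, inter_subset_right,
    hcore.inter hC (by rwa [measure_congr hinter]), ?_⟩
  rintro ⟨B₁, B₂, h₁, h₂, hdisj, hB₁, hB₂⟩
  have key : ∀ B ⊆ X.core F ∩ C, X.AlmostClosed 1 B → X.AlmostClosed m (B ∩ A) := by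
    intro B hB hBac
    refine (hBac.of_one hm).inter hA.1 fun h0 => hBac.measure_L_ne_zero ?_
    have hLB : X.L 1 B ≤ᵐ[X.μ] F :=
      (X.L_mono (hB.trans inter_subset_left)).eventuallyLE.trans hLcore.le
    have hG : IsInvariantEvent 1 (X.L 1 B) := X.isInvariantEvent_L 1 B
    have hGm : IsInvariantEvent m (X.L 1 B) :=
      ⟨hG.1, fun ω => by
        conv_lhs => rw [← hG.2.preimage_mul_eq m, mul_one]
        rfl⟩
    have hGE : X.μ (X.L 1 B ∩ E) = 0 :=
      measure_mono_null (inter_subset_inter_left _ (X.L_one_subset_L hm)) h0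
    have hGF : X.μ (X.L 1 B ∩ F) = 0 := by
      rw [hF, inter_iUnion]
      refine measure_iUnion_null fun j => ?_
      have := (measure_shift_eq_zero_iff hirr hap hm (hGm.inter hEinv) j).2 hGE
      rwa [preimage_inter, ← mul_one j, hG.2.preimage_mul_eq, mul_one] at this
    have hle : X.L 1 B ≤ᵐ[X.μ] (X.L 1 B ∩ F : Set (ℕ → S)) :=
      hLB.mono fun ω h hω => ⟨hω, h hω⟩
    exact nonpos_iff_eq_zero.1 ((measure_mono_ae hle).trans hGF.le)
  exact hA.2 ⟨B₁ ∩ A, B₂ ∩ A, inter_subset_right, inter_subset_right,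
    hdisj.mono inter_subset_left inter_subset_left, key B₁ h₁ hB₁, key B₂ h₂ hB₂⟩

/-- A chain that is simple and nonatomic has simple and nonatomic `m`-step chains. -/
lemma Simple.beta_eq_one_of_not_atomic (hirr : X.Irreducible) (hap : X.Aperiodic)
    (hsimple : X.Simple) (hX : ¬ X.Atomic 1 univ) (hm : 0 < m) :
    X.beta m = 1 ∧ ¬ X.Atomic m univ := by
  obtain ⟨C, hC⟩ := hsimple.exists_isBlackwell
  have hCac : X.AlmostClosed 1 C := hC.almostClosed C rfl
  have hC1 : X.μ (X.L 1 C) = 1 := by simpa using hC.measure_iUnion_L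
  have hCnull : X.μ (X.L 1 C)ᶜ = 0 := (prob_compl_eq_zero_iff (X.measurableSet_L 1 C)).2 hC1
  have hinter : ∀ D, X.AlmostClosed 1 D → X.AlmostClosed 1 (D ∩ C) := fun D hD =>
    hD.inter hCac fun h0 => hD.measure_L_ne_zero
      ((measure_inter_conull hCnull).symm.trans h0)
  obtain ⟨A, B, -, -, hAB, hA, hB⟩ : ∃ A B : Set S, A ⊆ univ ∧ B ⊆ univ ∧ Disjoint A B ∧
      X.AlmostClosed 1 A ∧ X.AlmostClosed 1 B := by
    by_contra h
    exact hX ⟨X.almostClosed_univ 1, h⟩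
  have hCm : ¬ X.Atomic m C := fun h => h.2 ⟨A ∩ C, B ∩ C, inter_subset_right,
    inter_subset_right, hAB.mono inter_subset_left inter_subset_left,
    (hinter A hA).of_one hm, (hinter B hB).of_one hm⟩
  have hC1' : ¬ X.Atomic 1 C := fun h => h.2 ⟨A ∩ C, B ∩ C, inter_subset_right,
    inter_subset_right, hAB.mono inter_subset_left inter_subset_left, hinter A hA, hinter B hB⟩
  refine ⟨le_antisymm ?_ one_le_beta, fun h => hCm (h.of_subset (hCac.of_one hm) (subset_univ C))⟩
  refine sInf_le ⟨{C}, ?_, encard_singleton C⟩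
  exact
    { countable := countable_singleton C
      almostClosed := by rintro _ rfl; exact hCac.of_one hm
      disjoint := pairwiseDisjoint_singleton _ _
      atMostOneNonatomic := by rintro _ rfl _ rfl _ _; rfl
      nonatomicNoAtomicSubset := by
        rintro _ rfl - A - hA
        obtain ⟨D, hDC, hD⟩ := hA.exists_atomic_one hirr hap hm hCac hC1
        exact hC.nonatomicNoAtomicSubset _ rfl hC1' D hDC hD
      nonatomicTransientStates := by
        rintro _ rfl - i hi
        exact measure_mono_null (X.U_subset_U_one hm)
          (hC.nonatomicTransientStates _ rfl hC1' i hi)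
      sum_L_eq_one := by
        rw [tsum_measure_L (countable_singleton C) (pairwiseDisjoint_singleton _ _),
          biUnion_singleton]
        exact le_antisymm prob_le_one (hC1.symm.le.trans (measure_mono (X.L_one_subset_L hm))) }

/-- Pairwise disjoint atomic sets are at most as many as the members of any Blackwell
decomposition. -/
lemma IsBlackwell.le_encard {𝒞 : Set (Set S)} (h𝒞 : X.IsBlackwell m 𝒞) {b : ℕ} {C : ℕ → Set S}
    (hC : ∀ i < b, X.Atomic m (C i)) (hd : ∀ i < b, ∀ j < b, i ≠ j → Disjoint (C i) (C j)) :
    (b : ℕ∞) ≤ 𝒞.encard := by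
  have hex : ∀ i < b, ∃ D ∈ 𝒞, X.AlmostClosed m (C i ∩ D) := by
    intro i hi
    by_contra! H
    have hnull : X.μ (⋃ D ∈ 𝒞, X.L m (C i) ∩ X.L m D) = 0 := by
      refine (measure_biUnion_null_iff h𝒞.countable).2 fun D hD => ?_
      by_contra h0
      exact H D hD ((hC i hi).1.inter (h𝒞.almostClosed D hD) h0)
    have hfull : X.μ (⋃ D ∈ 𝒞, X.L m D)ᶜ = 0 :=
      (prob_compl_eq_zero_iff (.biUnion h𝒞.countable fun D _ => X.measurableSet_L m D)).2
        h𝒞.measure_iUnion_L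
    rw [← inter_iUnion₂, measure_inter_conull hfull] at hnull
    exact (hC i hi).1.measure_L_ne_zero hnull
  choose! f hf𝒞 hf using hex
  have hinj : InjOn f (Iio b) := by
    intro i hi j hj hij
    by_contra hne
    have hj' := hf j hj
    rw [← hij] at hj'
    have hnot : ¬ X.Atomic m (f i) := fun h => h.2 ⟨_, _, inter_subset_right, inter_subset_right,
      (hd i hi j hj hne).mono inter_subset_left inter_subset_left, hf i hi, hj'⟩
    exact h𝒞.nonatomicNoAtomicSubset _ (hf𝒞 i hi) hnot _ inter_subset_right
      ((hC i hi).of_subset (hf i hi) inter_subset_left)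
  calc (b : ℕ∞) = (Iio b).encard := by
        rw [← Finset.coe_Iio, encard_coe_eq_coe_finsetCard, Nat.card_Iio]
    _ = (f '' Iio b).encard := hinj.encard_image.symm
    _ ≤ 𝒞.encard := encard_le_encard (image_subset_iff.2 hf𝒞)

lemma cond_image_shift_eq_one (hirr : X.Irreducible) (hap : X.Aperiodic)
    {E F : Set (ℕ → S)} (hE : IsInvariantEvent m E) (hF : IsInvariantEvent m F)
    (h0 : X.μ E ≠ 0) (h : E ≤ᵐ[X.μ] pathShift^[1] ⁻¹' F) {j : ℕ} (hj : j < m) :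
    X.μ[|pathShift^[j + 1] '' E] (pathShift^[j] '' F) = 1 := by
  have hm : 0 < m := by omega
  rw [hE.2.image_eq hj, hF.2.image_eq hj.le, cond_apply (hE.shift _).1]
  have hle := shift_ae_le hirr hap hm hE (hF.shift 1) h (m - (j + 1))
  rw [← preimage_iterate_add, show 1 + (m - (j + 1)) = m - j by omega] at hle
  have hne := (measure_shift_eq_zero_iff hirr hap hm hE (m - (j + 1))).not.2 h0
  have hae : (pathShift^[m - (j + 1)] ⁻¹' E ∩ pathShift^[m - j] ⁻¹' F : Set (ℕ → S)) =ᵐ[X.μ]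
      pathShift^[m - (j + 1)] ⁻¹' E :=
    inter_subset_left.eventuallyLE.antisymm (hle.mono fun ω hω hωE => ⟨hωE, hω hωE⟩)
  rw [measure_congr hae]
  exact ENNReal.inv_mul_cancel hne (measure_ne_top _ _)

/-- The cyclic Blackwell decomposition of the `m`-step chain of a chain that is atomic. -/
lemma Atomic.exists_cyclic_isBlackwell (hirr : X.Irreducible) (hap : X.Aperiodic)
    (hX : X.Atomic 1 univ) (hm : 0 < m) :
    ∃ (b : ℕ) (C : ℕ → Set S), b ∣ m ∧ X.beta m = (b : ℕ∞) ∧ InjOn C (Iio b) ∧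
      X.IsBlackwell m (C '' Iio b) ∧ (∀ i < b, X.Atomic m (C i)) ∧
      ∀ i < b, X.L m (C i) ≤ᵐ[X.μ] pathShift^[1] ⁻¹' X.L m (C ((i + 1) % b)) := by
  obtain ⟨b, E, hbm, hE, hEd, hEfull, hEshift⟩ := hX.exists_cyclic_atoms hirr hap hm
  have hLE : ∀ i < b, X.L m (X.core (E i)) =ᵐ[X.μ] E i := fun i hi =>
    X.L_core_ae_eq hm (hE i hi).1
  have hat : ∀ i < b, X.Atomic m (X.core (E i)) := fun i hi =>
    .of_L_ae_eq (X.almostClosed_core hm (hE i hi).1 (hE i hi).2) (hE i hi) (hLE i hi)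
  have hd : ∀ i < b, ∀ j < b, i ≠ j → Disjoint (X.core (E i)) (X.core (E j)) :=
    fun i hi j hj hij => disjoint_core hirr hap hm (hE i hi).1 (hE j hj).1 (hEd i hi j hj hij)
  have hinj : InjOn (fun i => X.core (E i)) (Iio b) := by
    intro i hi j hj hij
    by_contra hne
    have hdis := hd i hi j hj hne
    rw [show X.core (E i) = X.core (E j) from hij] at hdis
    refine (hat j hj).1.measure_L_ne_zero ?_
    rw [disjoint_self.1 (X.disjoint_L hdis)]
    simp
  have hcount : ((fun i => X.core (E i)) '' Iio b).Countable := (to_countable _).image _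
  have hdisj : ((fun i => X.core (E i)) '' Iio b).PairwiseDisjoint id := by
    rintro _ ⟨i, hi, rfl⟩ _ ⟨j, hj, rfl⟩ hij
    exact hd i hi j hj fun h => hij (by rw [h])
  have hB : X.IsBlackwell m ((fun i => X.core (E i)) '' Iio b) :=
    { countable := hcount
      almostClosed := by rintro _ ⟨i, hi, rfl⟩; exact (hat i hi).1
      disjoint := hdisj
      atMostOneNonatomic := by rintro _ ⟨i, hi, rfl⟩ _ - h; exact absurd (hat i hi) h
      nonatomicNoAtomicSubset := by rintro _ ⟨i, hi, rfl⟩ h; exact absurd (hat i hi) h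
      nonatomicTransientStates := by rintro _ ⟨i, hi, rfl⟩ h; exact absurd (hat i hi) h
      sum_L_eq_one := by
        rw [tsum_measure_L hcount hdisj, biUnion_image]
        have hae : (⋃ i ∈ Iio b, X.L m (X.core (E i)) : Set (ℕ → S)) =ᵐ[X.μ] ⋃ i ∈ Iio b, E i :=
          Filter.EventuallyEq.countable_bUnion (to_countable _) hLE
        rw [measure_congr hae]
        exact (prob_compl_eq_zero_iff (.biUnion (to_countable _) fun i hi => (hE i hi).1.1)).1
          hEfull }
  refine ⟨b, fun i => X.core (E i), hbm, le_antisymm ?_ ?_, hinj, hB, hat, fun i hi => ?_⟩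
  · refine sInf_le ⟨_, hB, ?_⟩
    rw [hinj.encard_image, ← Finset.coe_Iio, encard_coe_eq_coe_finsetCard, Nat.card_Iio]
  · refine le_sInf ?_
    rintro _ ⟨𝒞, h𝒞, rfl⟩
    exact IsBlackwell.le_encard h𝒞 hat hd
  · have hi' : (i + 1) % b < b := Nat.mod_lt _ (by omega)
    exact ((hLE i hi).trans (hEshift i hi)).le.trans
      (shift_ae_eq hirr hap hm (hE _ hi').1 (X.isInvariantEvent_L m _) (hLE _ hi').symm 1).le

end Blackwell

end MarkovChain

variable {S : Type} [MeasurableSpace S] [MeasurableSingletonClass S]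
  [Countable S] [Infinite S]

/-- If `X` is simple and atomic and `m > 1`, then `β := β(X^(m))` is a
divisor of `m` and there is a Blackwell decomposition `{C_0, ..., C_{β-1}}` for
`X^(m)` of pairwise disjoint atomic almost closed sets satisfying
`ℙ(θ^j L^(m)(C_{i+1 mod β}) | θ^{j+1} L^(m)(C_i)) = 1` for all `i < β`, `j < m`.
Moreover, if `X` is simple and nonatomic, then `X^(m)` is simple and nonatomic
for all `m ≥ 1`. -/
theorem stmt4 (X : MarkovChain S) (hirr : X.Irreducible) (hap : X.Aperiodic)
    (hsimple : X.Simple) :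
    (X.Atomic 1 Set.univ → ∀ m : ℕ, 1 < m →
      ∃ (b : ℕ) (C : ℕ → Set S), b ∣ m ∧ X.beta m = (b : ℕ∞) ∧
        Set.InjOn C (Set.Iio b) ∧
        X.IsBlackwell m (C '' Set.Iio b) ∧
        (∀ i < b, X.Atomic m (C i)) ∧
        (∀ i < b, ∀ j < m,
          (X.μ[|pathShift^[j + 1] '' X.L m (C i)])
            (pathShift^[j] '' X.L m (C ((i + 1) % b))) = 1)) ∧
    (¬ X.Atomic 1 Set.univ → ∀ m : ℕ, 1 ≤ m →
      X.beta m = 1 ∧ ¬ X.Atomic m Set.univ) := by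
  refine ⟨fun hX m hm => ?_, fun hX m hm => hsimple.beta_eq_one_of_not_atomic hirr hap hX hm⟩
  obtain ⟨b, C, hbm, hbeta, hinj, hB, hat, hshift⟩ :=
    hX.exists_cyclic_isBlackwell hirr hap (zero_lt_one.trans hm)
  exact ⟨b, C, hbm, hbeta, hinj, hB, hat, fun i hi j hj =>
    MarkovChain.cond_image_shift_eq_one hirr hap (X.isInvariantEvent_L m _)
      (X.isInvariantEvent_L m _) (hat i hi).1.measure_L_ne_zero (hshift i hi) hj⟩
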